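/- arXiv:1803.01590 — 2 statements merged into one kernel-verified Lean document; each statement's English description precedes it below -/
import Mathlib

section
/- For every positive integer n and every integer k with 0 ≤ k ≤ n, the polynomial identity [n−k+1]_q · Σ_{T ∈ RInc_k(2×n)} q^{maj(T)} = q^{n+k(k−3)/2} · [2n−k choose k]_q · [2n−2k choose n−k]_q holds in ℤ[q]. (Note that n + k(k−3)/2 is a nonnegative integer for 0 ≤ k ≤ n.) -/
open Polynomial

/-- The q-integer `[n]_q = 1 + q + ⋯ + q^(n-1)` in `ℤ[q]`. -/
noncomputable def qInt (n : ℕ) : Polynomial ℤ := ∑ i ∈ Finset.range n, X ^ i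

/-- The Gaussian binomial coefficient `[a choose b]_q` in `ℤ[q]`, defined by the
standard q-Pascal recurrence `[n+1 choose k+1] = [n choose k] + q^(k+1) [n choose k+1]`. -/
noncomputable def qBinom : ℕ → ℕ → Polynomial ℤ
  | _, 0 => 1
  | 0, _ + 1 => 0
  | n + 1, k + 1 => qBinom n k + X ^ (k + 1) * qBinom n (k + 1)

/-- Major index: sum of all `i` such that `i` appears in row 1 and `i+1` appears in row 2. -/
def maj {n : ℕ} (T : (Fin n → ℕ) × (Fin n → ℕ)) : ℕ :=
  ∑ i ∈ (Finset.image T.1 Finset.univ).filter (fun i => ∃ j, T.2 j = i + 1), i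

/-- Row-increasing tableaux of shape 2×n with entry set `{1, …, 2n−k}`:
rows strictly increasing, columns weakly increasing. -/
def RInc (n k : ℕ) : Set ((Fin n → ℕ) × (Fin n → ℕ)) :=
  {T | StrictMono T.1 ∧ StrictMono T.2 ∧ (∀ i, T.1 i ≤ T.2 i) ∧
    Set.range T.1 ∪ Set.range T.2 = Set.Icc 1 (2 * n - k)}

/-- shifted Gaussian binomial `[n choose k-1]` -/
noncomputable def qE (n : ℕ) : ℕ → Polynomial ℤ
  | 0 => 0
  | k + 1 => qBinom n k

theorem qBinom_zero_right (n : ℕ) : qBinom n 0 = 1 := by cases n <;> simp [qBinom]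

theorem qBinom_succ (n k : ℕ) :
    qBinom (n + 1) (k + 1) = qBinom n k + X ^ (k + 1) * qBinom n (k + 1) := by
  rw [qBinom]

theorem qBinom_gt (n : ℕ) : ∀ k, n < k → qBinom n k = 0 := by
  induction n with
  | zero => intro k hk; cases k with
    | zero => omega
    | succ k => simp [qBinom]
  | succ n ih => intro k hk; cases k with
    | zero => omega
    | succ k => rw [qBinom_succ, ih k (by omega), ih (k + 1) (by omega)]; simp

theorem qBinom_absorb (n : ℕ) : ∀ k j, n = k + j →
    (1 - X ^ j) * qBinom n k = (1 - X ^ (k + 1)) * qBinom n (k + 1) := by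
  induction n with
  | zero =>
    intro k j h
    obtain rfl : k = 0 := by omega
    obtain rfl : j = 0 := by omega
    simp [qBinom]
  | succ n ih =>
    intro k j h
    cases k with
    | zero =>
      obtain rfl : j = n + 1 := by omega
      have := ih 0 n (by omega)
      rw [qBinom_succ]
      simp only [qBinom_zero_right] at *
      linear_combination X * this
    | succ k =>
      have h1 := ih k j (by omega)
      cases j with
      | zero =>
        rw [qBinom_gt (n + 1) (k + 1 + 1) (by omega)]; simp
      | succ j =>
        have h2 := ih (k + 1) j (by omega)
        rw [qBinom_succ, qBinom_succ]
        linear_combination h1 + X ^ (k + 2) * h2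

theorem qBinom_pascal2 (n k j : ℕ) (h : n = k + j) :
    qBinom (n + 1) (k + 1) = X ^ j * qBinom n k + qBinom n (k + 1) := by
  rw [qBinom_succ]
  linear_combination qBinom_absorb n k j h

theorem one_sub_X_pow_ne (j : ℕ) : (1 - X ^ (j + 1) : Polynomial ℤ) ≠ 0 := by
  intro h
  have := congrArg (Polynomial.eval 2) h
  simp at this
  have h2 : (2:ℤ) ^ (j + 1) = 1 := by linarith
  have : (1:ℤ) < 2 ^ (j + 1) := one_lt_pow₀ (by norm_num) (by omega)
  omega

theorem qBinom_mid (u : ℕ) : qBinom (2 * u + 1) (u + 1) = qBinom (2 * u + 1) u := by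
  have := qBinom_absorb (2 * u + 1) u (u + 1) (by omega)
  exact (mul_left_cancel₀ (one_sub_X_pow_ne u) this).symm

theorem qInt_mul (n : ℕ) : qInt n * (1 - X) = 1 - X ^ n := by
  unfold qInt; exact geom_sum_mul_neg X n

noncomputable def BU : ℕ → ℕ → Polynomial ℤ
  | 0, _ => 0
  | u + 1, d => qBinom (u + d) d - qE (u + d) d

noncomputable def BD : ℕ → ℕ → Polynomial ℤ
  | u, 0 => if u = 0 then 1 else 0
  | u, d + 1 => X ^ u * qBinom (u + d) d - X ^ (u + 1) * qE (u + d) d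

theorem BU_add_BD (u d : ℕ) (h : d ≤ u) : BU u d + BD u d = BU (u + 1) d := by
  cases u with
  | zero =>
    obtain rfl : d = 0 := by omega
    simp [BU, BD, qE, qBinom]
  | succ u =>
    cases d with
    | zero => simp [BU, BD, qE, qBinom_zero_right]
    | succ d =>
      simp only [BU, BD, qE]
      have e1 : u + 1 + (d + 1) = (u + d + 1) + 1 := by ring
      have e2 : u + (d + 1) = u + d + 1 := by ring
      have e3 : u + 1 + d = u + d + 1 := by ring
      rw [e1, e2, e3, qBinom_pascal2 (u + d + 1) d (u + 1) (by omega)]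
      cases d with
      | zero => simp [qE, qBinom_zero_right]; ring
      | succ d =>
        rw [qBinom_pascal2 (u + (d + 1) + 1) d (u + 2) (by omega)]
        simp only [qE]; ring

theorem BD_step (u d : ℕ) (h : d ≤ u) : BD u d + X ^ (u + d) * BU u d = BD u (d + 1) := by
  cases u with
  | zero =>
    obtain rfl : d = 0 := by omega
    simp [BU, BD, qE, qBinom]
  | succ u =>
    cases d with
    | zero => simp [BU, BD, qE, qBinom_zero_right]
    | succ d =>
      simp only [BU, BD, qE]
      have e1 : u + 1 + (d + 1) = (u + d + 1) + 1 := by ring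
      have e2 : u + (d + 1) = u + d + 1 := by ring
      have e3 : u + 1 + d = u + d + 1 := by ring
      rw [e1, e2, e3, qBinom_succ (u + d + 1) d]
      cases d with
      | zero => simp [qE, qBinom_zero_right]; ring
      | succ d =>
        rw [qBinom_succ (u + (d + 1) + 1) d]
        simp only [qE]; ring

theorem BU_diag (u : ℕ) : BU (u + 1) (u + 1) = 0 := by
  simp only [BU, qE]
  rw [show u + (u + 1) = 2 * u + 1 by ring, qBinom_mid, sub_self]

theorem BU_final (m : ℕ) : qInt (m + 1) * BU (m + 1) m = X ^ m * qBinom (2 * m) m := by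
  have h1 : (1 - X : Polynomial ℤ) ≠ 0 := by simpa using one_sub_X_pow_ne 0
  apply mul_left_cancel₀ h1
  have h2 := qInt_mul (m + 1)
  cases m with
  | zero => simp [BU, qE, qBinom, qInt]
  | succ m =>
    simp only [BU, qE]
    rw [show m + 1 + (m + 1) = 2 * (m + 1) by ring]
    have h3 := qBinom_absorb (2 * (m + 1)) m (m + 2) (by omega)
    linear_combination (qBinom (2 * (m + 1)) (m + 1) - qBinom (2 * (m + 1)) m) * h2 - h3

/-- Set-pair model. -/
noncomputable def Good (N a b : ℕ) : Finset (Finset ℕ × Finset ℕ) :=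
  open Classical in
  ((Finset.Icc 1 N).powerset ×ˢ (Finset.Icc 1 N).powerset).filter fun p =>
    p.1 ∪ p.2 = Finset.Icc 1 N ∧ p.1.card = a ∧ p.2.card = b ∧
      ∀ j, (p.2.filter (· ≤ j)).card ≤ (p.1.filter (· ≤ j)).card

def wt (p : Finset ℕ × Finset ℕ) : ℕ := ∑ i ∈ p.1.filter (fun i => i + 1 ∈ p.2), i

theorem mem_Good {N a b : ℕ} {p : Finset ℕ × Finset ℕ} : p ∈ Good N a b ↔
    p.1 ∪ p.2 = Finset.Icc 1 N ∧ p.1.card = a ∧ p.2.card = b ∧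
      ∀ j, (p.2.filter (· ≤ j)).card ≤ (p.1.filter (· ≤ j)).card := by
  unfold Good
  simp only [Finset.mem_filter, Finset.mem_product, Finset.mem_powerset, and_iff_right_iff_imp]
  rintro ⟨h, -⟩
  rw [← h]
  exact ⟨Finset.subset_union_left, Finset.subset_union_right⟩

noncomputable def TT (N a b : ℕ) : Polynomial ℤ := ∑ p ∈ Good N a b, X ^ wt p
noncomputable def TU (N a b : ℕ) : Polynomial ℤ :=
  ∑ p ∈ (Good N a b).filter (fun p => N ∈ p.1 ∧ N ∉ p.2), X ^ wt p
noncomputable def TD (N a b : ℕ) : Polynomial ℤ :=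
  ∑ p ∈ (Good N a b).filter (fun p => N ∉ p.1), X ^ wt p
noncomputable def TH (N a b : ℕ) : Polynomial ℤ :=
  ∑ p ∈ (Good N a b).filter (fun p => N ∈ p.1 ∧ N ∈ p.2), X ^ wt p
noncomputable def TG (N a b : ℕ) : Polynomial ℤ :=
  ∑ p ∈ Good N a b, X ^ (wt p + if N ∈ p.1 then N else 0)

theorem TT_eq (N a b : ℕ) : TT N a b = TU N a b + TD N a b + TH N a b := by
  unfold TT TU TD TH
  simp only [Finset.sum_filter, ← Finset.sum_add_distrib]
  refine Finset.sum_congr rfl fun p _ => ?_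
  by_cases h1 : N ∈ p.1 <;> by_cases h2 : N ∈ p.2 <;> simp [h1, h2]

theorem TG_eq (N a b : ℕ) : TG N a b = TD N a b + X ^ N * (TU N a b + TH N a b) := by
  unfold TG TU TD TH
  simp only [Finset.sum_filter, ← Finset.sum_add_distrib, Finset.mul_sum]
  refine Finset.sum_congr rfl fun p _ => ?_
  by_cases h1 : N ∈ p.1 <;> by_cases h2 : N ∈ p.2 <;> simp [h1, h2, pow_add, mul_comm]

theorem Good_empty {N a b : ℕ} (h : a < b ∨ N < a ∨ a + b < N) : Good N a b = ∅ := by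
  rw [Finset.eq_empty_iff_forall_notMem]
  intro p hp
  rw [mem_Good] at hp
  obtain ⟨h1, h2, h3, h4⟩ := hp
  have c1 := Finset.card_le_card (Finset.subset_union_left (s₁ := p.1) (s₂ := p.2))
  have c2 := Finset.card_union_le p.1 p.2
  rw [h1] at c1 c2
  simp only [Nat.card_Icc] at c1 c2
  have c3 := h4 N
  have f : ∀ x ∈ p.1 ∪ p.2, x ≤ N := by
    rw [h1]; intro x hx; exact (Finset.mem_Icc.1 hx).2
  rw [Finset.filter_true_of_mem (fun x hx => f x (Finset.mem_union_right _ hx)),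
    Finset.filter_true_of_mem (fun x hx => f x (Finset.mem_union_left _ hx))] at c3
  omega

/-- conditionally insert -/
def ins (M : ℕ) (x : Bool) (A : Finset ℕ) : Finset ℕ := if x then insert M A else A

theorem mem_ins {M : ℕ} {x : Bool} {A : Finset ℕ} {i : ℕ} :
    i ∈ ins M x A ↔ (i = M ∧ x = true) ∨ i ∈ A := by
  cases x <;> simp [ins]

theorem card_ins_filter {M : ℕ} (x : Bool) {A : Finset ℕ} (h : M ∉ A) (j : ℕ) :
    ((ins M x A).filter (· ≤ j)).card = (A.filter (· ≤ j)).card +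
      if M ≤ j then x.toNat else 0 := by
  cases x
  · simp [ins]
  · simp only [ins, if_true, Finset.filter_insert]
    split_ifs with h1
    · rw [Finset.card_insert_of_notMem (by simp [h])]; simp
    · simp

theorem card_ins {M : ℕ} (x : Bool) {A : Finset ℕ} (h : M ∉ A) :
    (ins M x A).card = A.card + x.toNat := by
  cases x
  · simp [ins]
  · simp only [ins, if_true]
    rw [Finset.card_insert_of_notMem h]; simp

theorem ins_erase {M : ℕ} {x : Bool} {A : Finset ℕ} (h : M ∈ A ↔ x = true) :
    ins M x (A.erase M) = A := by
  cases x
  · simp only [ins]; simp at h; simp [h]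
  · simp only [ins, if_true]; simp at h; exact Finset.insert_erase h

theorem erase_ins {M : ℕ} {x : Bool} {A : Finset ℕ} (h : M ∉ A) :
    (ins M x A).erase M = A := by
  cases x
  · simp [ins, h]
  · simp [ins, h]

theorem Good_sub {N a b : ℕ} {p : Finset ℕ × Finset ℕ} (hp : p ∈ Good N a b) :
    p.1 ⊆ Finset.Icc 1 N ∧ p.2 ⊆ Finset.Icc 1 N := by
  rw [mem_Good] at hp
  rw [← hp.1]
  exact ⟨Finset.subset_union_left, Finset.subset_union_right⟩

theorem filter_all {N j : ℕ} {A : Finset ℕ} (h : A ⊆ Finset.Icc 1 N) (hj : N ≤ j) :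
    A.filter (· ≤ j) = A := by
  apply Finset.filter_true_of_mem
  intro x hx
  have := (Finset.mem_Icc.1 (h hx)).2
  omega

theorem Good_ins {N a b : ℕ} (x y : Bool) (hxy : (x || y) = true) {A B : Finset ℕ}
    (hA : N + 1 ∉ A) (hB : N + 1 ∉ B) (hab : b + y.toNat ≤ a + x.toNat) (hba : b ≤ a) :
    (ins (N + 1) x A, ins (N + 1) y B) ∈ Good (N + 1) (a + x.toNat) (b + y.toNat) ↔
      (A, B) ∈ Good N a b := by
  simp only [mem_Good, card_ins x hA, card_ins y hB, card_ins_filter x hA, card_ins_filter y hB,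
    Nat.add_right_cancel_iff]
  have hU : ins (N + 1) x A ∪ ins (N + 1) y B = Finset.Icc 1 (N + 1) ↔ A ∪ B = Finset.Icc 1 N := by
    simp only [Finset.ext_iff, Finset.mem_union, mem_ins, Finset.mem_Icc]
    have hxy' : x = true ∨ y = true := by simpa using hxy
    constructor
    · intro h i
      have := h i
      by_cases hi : i = N + 1
      · subst hi; simp [hA, hB]
      · simp only [hi, false_and, false_or] at this
        rw [this]; omega
    · intro h i
      have := h i
      by_cases hi : i = N + 1
      · subst hi; simp; tauto
      · simp only [hi, false_and, false_or]
        rw [this]; omega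
  rw [hU]
  refine and_congr_right fun h1 => and_congr_right fun h2 => and_congr_right fun h3 => ?_
  have sA : A ⊆ Finset.Icc 1 N := h1 ▸ Finset.subset_union_left
  have sB : B ⊆ Finset.Icc 1 N := h1 ▸ Finset.subset_union_right
  refine forall_congr' fun j => ?_
  by_cases hj : N + 1 ≤ j
  · simp only [hj, if_true]
    rw [filter_all sA (by omega), filter_all sB (by omega)]
    omega
  · simp only [hj, if_false]; simp

theorem wt_ins {N : ℕ} (x y : Bool) {A B : Finset ℕ}
    (sA : A ⊆ Finset.Icc 1 N) (sB : B ⊆ Finset.Icc 1 N) :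
    wt (ins (N + 1) x A, ins (N + 1) y B) = wt (A, B) + if y = true ∧ N ∈ A then N else 0 := by
  have bA : ∀ i ∈ A, i ≤ N := fun i hi => (Finset.mem_Icc.1 (sA hi)).2
  have bB : ∀ i ∈ B, i ≤ N := fun i hi => (Finset.mem_Icc.1 (sB hi)).2
  unfold wt
  simp only
  split_ifs with h
  · obtain ⟨rfl, hN⟩ := h
    have : (ins (N + 1) x A).filter (fun i => i + 1 ∈ ins (N + 1) true B) =
        insert N (A.filter (fun i => i + 1 ∈ B)) := by
      ext i
      simp only [Finset.mem_filter, mem_ins, Finset.mem_insert]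
      have b1 := bA i; have b2 := bB (i + 1)
      grind
    rw [this, Finset.sum_insert, add_comm]
    simp only [Finset.mem_filter, not_and]
    intro _ h
    have := bB _ h
    omega
  · rw [add_zero]
    congr 1
    ext i
    simp only [Finset.mem_filter, mem_ins]
    have b1 := bA i; have b2 := bB (i + 1)
    grind

theorem sum_step {N a b : ℕ} (x y : Bool) (hxy : (x || y) = true)
    (hab : b + y.toNat ≤ a + x.toNat) (hba : b ≤ a) :
    ∑ p ∈ (Good (N + 1) (a + x.toNat) (b + y.toNat)).filter
        (fun p => (N + 1 ∈ p.1 ↔ x = true) ∧ (N + 1 ∈ p.2 ↔ y = true)), (X : Polynomial ℤ) ^ wt p =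
    ∑ p ∈ Good N a b, X ^ (wt p + if y = true ∧ N ∈ p.1 then N else 0) := by
  have nm : ∀ {p}, p ∈ Good N a b → N + 1 ∉ p.1 ∧ N + 1 ∉ p.2 := by
    intro p hp
    have := Good_sub hp
    constructor
    · intro h; have := Finset.mem_Icc.1 (this.1 h); omega
    · intro h; have := Finset.mem_Icc.1 (this.2 h); omega
  symm
  refine Finset.sum_nbij' (fun p => (ins (N + 1) x p.1, ins (N + 1) y p.2))
    (fun p => (p.1.erase (N + 1), p.2.erase (N + 1))) ?_ ?_ ?_ ?_ ?_
  · intro p hp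
    obtain ⟨n1, n2⟩ := nm hp
    rw [Finset.mem_filter]
    refine ⟨(Good_ins x y hxy n1 n2 hab hba).2 hp, ?_⟩
    simp [mem_ins, n1, n2]
  · intro p hp
    rw [Finset.mem_filter] at hp
    obtain ⟨hp, h1, h2⟩ := hp
    rw [← Good_ins x y hxy (by simp) (by simp) hab hba, ins_erase h1, ins_erase h2]
    exact hp
  · intro p hp
    obtain ⟨n1, n2⟩ := nm hp
    simp [erase_ins n1, erase_ins n2]
  · intro p hp
    rw [Finset.mem_filter] at hp
    obtain ⟨hp, h1, h2⟩ := hp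
    simp [ins_erase h1, ins_erase h2]
  · intro p hp
    rw [wt_ins x y (Good_sub hp).1 (Good_sub hp).2]

theorem TU_step {N a b : ℕ} (hba : b ≤ a) : TU (N + 1) (a + 1) b = TT N a b := by
  have := sum_step (N := N) (a := a) (b := b) true false rfl (by simp; omega) hba
  simpa [TU, TT] using this

theorem TH_step {N a b : ℕ} (hba : b ≤ a) : TH (N + 1) (a + 1) (b + 1) = TG N a b := by
  have := sum_step (N := N) (a := a) (b := b) true true rfl (by simp; omega) hba
  simpa [TH, TG] using this

theorem TD_step {N a b : ℕ} (hba : b + 1 ≤ a) : TD (N + 1) a (b + 1) = TG N a b := by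
  have := sum_step (N := N) (a := a) (b := b) false true rfl (by simp; omega) (by omega)
  simp only [Bool.toNat_false, Bool.toNat_true, add_zero, true_and] at this
  rw [TG, ← this, TD]
  congr 1
  refine Finset.filter_congr fun p hp => ?_
  rw [mem_Good] at hp
  have h : N + 1 ∈ p.1 ∪ p.2 := by rw [hp.1]; simp
  rw [Finset.mem_union] at h
  simp; tauto
  
theorem erase_filter_le {A B : Finset ℕ} {N a b : ℕ} (h : (A, B) ∈ Good (N + 1) a b) :
    (B.erase (N + 1)).card ≤ (A.erase (N + 1)).card ∧ (A.erase (N + 1)).card ≤ N ∧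
      N ≤ (A.erase (N + 1)).card + (B.erase (N + 1)).card := by
  have hs := Good_sub h
  rw [mem_Good] at h
  obtain ⟨h1, -, -, h4⟩ := h
  simp only at h1 h4 hs
  have e : ∀ C : Finset ℕ, C ⊆ Finset.Icc 1 (N + 1) → C.filter (· ≤ N) = C.erase (N + 1) := by
    intro C hC
    ext i
    simp only [Finset.mem_filter, Finset.mem_erase]
    constructor
    · rintro ⟨h1, h2⟩; exact ⟨by omega, h1⟩
    · rintro ⟨h1, h2⟩
      have := Finset.mem_Icc.1 (hC h2)
      exact ⟨h2, by omega⟩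
  have h5 := h4 N
  rw [e A hs.1, e B hs.2] at h5
  have h6 : A.erase (N + 1) ∪ B.erase (N + 1) = Finset.Icc 1 N := by
    ext i
    have := congrArg (i ∈ ·) h1
    simp only [Finset.mem_union, Finset.mem_Icc, eq_iff_iff] at this
    simp only [Finset.mem_union, Finset.mem_Icc, Finset.mem_erase, ← and_or_left, this]
    omega
  have c1 := Finset.card_le_card (Finset.subset_union_left (s₁ := A.erase (N + 1)) (s₂ := B.erase (N + 1)))
  have c2 := Finset.card_union_le (A.erase (N + 1)) (B.erase (N + 1))
  rw [h6] at c1 c2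
  simp only [Nat.card_Icc] at c1 c2
  omega

theorem TU_zero {N a b : ℕ} (h : a ≤ b) : TU (N + 1) a b = 0 := by
  unfold TU
  rw [Finset.sum_eq_zero]
  rintro ⟨A, B⟩ hp
  exfalso
  rw [Finset.mem_filter] at hp
  obtain ⟨hp, h1, h2⟩ := hp
  have := erase_filter_le hp
  rw [mem_Good] at hp
  simp only at h1 h2 hp
  rw [Finset.card_erase_of_mem h1, Finset.erase_eq_of_notMem h2] at this
  have := Finset.card_pos.2 ⟨_, h1⟩
  omega

theorem TD_zero {N a b : ℕ} (h : N + 1 ≤ a) : TD (N + 1) a b = 0 := by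
  unfold TD
  rw [Finset.sum_eq_zero]
  rintro ⟨A, B⟩ hp
  exfalso
  rw [Finset.mem_filter] at hp
  obtain ⟨hp, h1⟩ := hp
  have := erase_filter_le hp
  rw [mem_Good] at hp
  simp only at h1 hp
  rw [Finset.erase_eq_of_notMem h1] at this
  omega

theorem TH_zero {N a b : ℕ} (h : a + b ≤ N + 1) : TH (N + 1) a b = 0 := by
  unfold TH
  rw [Finset.sum_eq_zero]
  rintro ⟨A, B⟩ hp
  exfalso
  rw [Finset.mem_filter] at hp
  obtain ⟨hp, h1, h2⟩ := hp
  have := erase_filter_le hp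
  rw [mem_Good] at hp
  simp only at h1 h2 hp
  rw [Finset.card_erase_of_mem h1, Finset.card_erase_of_mem h2] at this
  have := Finset.card_pos.2 ⟨_, h1⟩
  have := Finset.card_pos.2 ⟨_, h2⟩
  omega

theorem Good_zero : Good 0 0 0 = {(∅, ∅)} := by
  ext ⟨A, B⟩
  rw [mem_Good]
  simp only [Finset.card_eq_zero, Finset.mem_singleton, Prod.mk.injEq]
  constructor
  · rintro ⟨-, h1, h2, -⟩; exact ⟨h1, h2⟩
  · rintro ⟨rfl, rfl⟩; simp

theorem pas1 (N h : ℕ) : X ^ h * qBinom N h + qE N h = qBinom (N + 1) h := by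
  cases h with
  | zero => simp [qE, qBinom_zero_right]
  | succ h => rw [qBinom_succ, qE]; ring

theorem pas2 (N h e : ℕ) (hN : N + 1 = e + h) :
    qBinom N h + X ^ e * qE N h = qBinom (N + 1) h := by
  cases h with
  | zero => simp [qE, qBinom_zero_right]
  | succ h => rw [qBinom_pascal2 N h e (by omega), qE]; ring

/-- closed forms for the three refined sums -/
def Closed (N u d h : ℕ) : Prop :=
    TU N (u + h) (d + h) = X ^ (h.choose 2) * qBinom (N - 1) h * BU u d ∧
    TD N (u + h) (d + h) = X ^ (h.choose 2) * X ^ h * qBinom (N - 1) h * BD u d ∧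
    TH N (u + h) (d + h) = X ^ (h.choose 2) * qE (N - 1) h * (X ^ (u + d) * BU u d + BD u d)

theorem TT_closed {N u d h : ℕ} (hN : u + d + h = N) (hd : d ≤ u) (hc : Closed N u d h) :
    TT N (u + h) (d + h) = X ^ (h.choose 2) * qBinom N h * BU (u + 1) d := by
  obtain ⟨h1, h2, h3⟩ := hc
  rw [TT_eq, h1, h2, h3, ← BU_add_BD u d hd]
  cases N with
  | zero =>
    obtain rfl : u = 0 := by omega
    obtain rfl : d = 0 := by omega
    obtain rfl : h = 0 := by omega
    simp [qE, BU, BD]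
  | succ N =>
    simp only [Nat.add_sub_cancel]
    have p1 := pas1 N h
    have p2 := pas2 N h (u + d) (by omega)
    linear_combination X ^ (h.choose 2) * (BD u d * p1 + BU u d * p2)

theorem TG_closed {N u d h : ℕ} (hN : u + d + h = N) (hd : d ≤ u) (hc : Closed N u d h) :
    TG N (u + h) (d + h) = X ^ (h.choose 2) * X ^ h * qBinom N h * BD u (d + 1) := by
  obtain ⟨h1, h2, h3⟩ := hc
  rw [TG_eq, h1, h2, h3, ← BD_step u d hd]
  cases N with
  | zero =>
    obtain rfl : u = 0 := by omega
    obtain rfl : d = 0 := by omega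
    obtain rfl : h = 0 := by omega
    simp [qE, BU, BD]
  | succ N =>
    simp only [Nat.add_sub_cancel]
    have p2 := pas2 N h (u + d) (by omega)
    have hX : (X : Polynomial ℤ) ^ (N + 1) = X ^ u * X ^ d * X ^ h := by
      rw [← hN, pow_add, pow_add]
    rw [hX]
    simp only [pow_add _ u d] at p2 ⊢
    linear_combination X ^ (h.choose 2) * X ^ h * (BD u d + X ^ u * X ^ d * BU u d) * p2

theorem T_closed (N : ℕ) : ∀ u d h, u + d + h = N → d ≤ u → Closed N u d h := by
  induction N with
  | zero =>
    intro u d h hN hd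
    obtain rfl : u = 0 := by omega
    obtain rfl : d = 0 := by omega
    obtain rfl : h = 0 := by omega
    simp [Closed, TU, TD, TH, Good_zero, Finset.filter_singleton, BU, BD, qE, qBinom, wt]
  | succ N ih =>
    intro u d h hN hd
    refine ⟨?_, ?_, ?_⟩
    · simp only [Nat.add_sub_cancel]
      by_cases hu : u = d
      · subst hu
        rw [TU_zero le_rfl]
        cases u with
        | zero => simp [BU]
        | succ u => rw [BU_diag]; simp
      · obtain ⟨u, rfl⟩ : ∃ v, u = v + 1 := ⟨u - 1, by omega⟩
        rw [show u + 1 + h = u + h + 1 by ring, TU_step (by omega)]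
        exact TT_closed (by omega) (by omega) (ih u d h (by omega) (by omega))
    · simp only [Nat.add_sub_cancel]
      cases d with
      | zero =>
        rw [TD_zero (by omega)]
        by_cases hu : u = 0
        · rw [qBinom_gt N h (by omega)]; simp
        · simp [BD, hu]
      | succ d =>
        rw [show d + 1 + h = d + h + 1 by ring, TD_step (by omega)]
        exact TG_closed (by omega) (by omega) (ih u d h (by omega) (by omega))
    · simp only [Nat.add_sub_cancel]
      cases h with
      | zero => rw [TH_zero (by omega)]; simp [qE]
      | succ h =>
        rw [← add_assoc, ← add_assoc, TH_step (by omega),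
          TG_closed (by omega) (by omega) (ih u d h (by omega) (by omega)), ← BD_step u d hd, qE,
          show (h + 1).choose 2 = h.choose 2 + h by
            rw [Nat.choose_succ_succ' h 1]; simp [add_comm]]
        ring

/-- the bridge -/
theorem col_iff {n : ℕ} {a b : Fin n → ℕ} (ha : StrictMono a) (hb : StrictMono b) :
    (∀ i, a i ≤ b i) ↔ ∀ j, ((Finset.univ.image b).filter (· ≤ j)).card ≤
      ((Finset.univ.image a).filter (· ≤ j)).card := by
  have key : ∀ {c : Fin n → ℕ}, StrictMono c → ∀ j, ((Finset.univ.image c).filter (· ≤ j)).card =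
      (Finset.univ.filter (fun i => c i ≤ j)).card := by
    intro c hc j
    rw [Finset.filter_image, Finset.card_image_of_injective _ hc.injective]
  simp only [key ha, key hb]
  constructor
  · intro h j
    apply Finset.card_le_card
    intro i
    simp only [Finset.mem_filter, Finset.mem_univ, true_and]
    exact fun hi => (h i).trans hi
  · intro h i
    by_contra! hc
    have h1 := h (b i)
    have h2 : Finset.univ.filter (fun i' => b i' ≤ b i) = Finset.Iic i := by
      ext i'; simp [hb.le_iff_le]
    have h3 : Finset.univ.filter (fun i' => a i' ≤ b i) ⊆ Finset.Iio i := by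
      intro i'
      simp only [Finset.mem_filter, Finset.mem_univ, true_and, Finset.mem_Iio]
      intro hi
      exact ha.lt_iff_lt.1 (hi.trans_lt hc)
    have h4 := Finset.card_le_card h3
    rw [h2, Fin.card_Iic] at h1
    rw [Fin.card_Iio] at h4
    omega

theorem strictMono_eq {n : ℕ} {a b : Fin n → ℕ} (ha : StrictMono a) (hb : StrictMono b)
    (h : Finset.univ.image a = Finset.univ.image b) : a = b := by
  apply (StrictMono.range_inj ha hb).1
  have := congrArg (fun s : Finset ℕ => (s : Set ℕ)) h
  simpa using this

theorem union_iff {n N : ℕ} (a b : Fin n → ℕ) :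
    Set.range a ∪ Set.range b = Set.Icc 1 N ↔
      Finset.univ.image a ∪ Finset.univ.image b = Finset.Icc 1 N := by
  rw [← Finset.coe_inj]
  simp

theorem bridge (n k : ℕ) :
    ∑ᶠ T ∈ RInc n k, (X : Polynomial ℤ) ^ maj T = TT (2 * n - k) n n := by
  unfold TT
  rw [← finsum_mem_coe_finset]
  refine finsum_mem_eq_of_bijOn (fun T => (Finset.univ.image T.1, Finset.univ.image T.2))
    ⟨?_, ?_, ?_⟩ ?_
  · rintro ⟨a, b⟩ ⟨ha, hb, hc, hu⟩
    simp only at ha hb hc hu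
    rw [Finset.mem_coe, mem_Good]
    refine ⟨(union_iff a b).1 hu, ?_, ?_, (col_iff ha hb).1 hc⟩
    · simp [Finset.card_image_of_injective _ ha.injective]
    · simp [Finset.card_image_of_injective _ hb.injective]
  · rintro ⟨a, b⟩ ⟨ha, hb, -⟩ ⟨a', b'⟩ ⟨ha', hb', -⟩ h
    simp only [Prod.mk.injEq] at h ⊢
    exact ⟨strictMono_eq ha ha' h.1, strictMono_eq hb hb' h.2⟩
  · rintro ⟨A, B⟩ h
    rw [Finset.mem_coe, mem_Good] at h
    obtain ⟨h1, h2, h3, h4⟩ := h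
    simp only at h1 h2 h3 h4
    have eA : Finset.univ.image (A.orderEmbOfFin h2) = A := by
      rw [← Finset.coe_inj]; simp
    have eB : Finset.univ.image (B.orderEmbOfFin h3) = B := by
      rw [← Finset.coe_inj]; simp
    refine ⟨(A.orderEmbOfFin h2, B.orderEmbOfFin h3), ⟨?_, ?_, ?_, ?_⟩, ?_⟩
    · exact (A.orderEmbOfFin h2).strictMono
    · exact (B.orderEmbOfFin h3).strictMono
    · rw [col_iff (A.orderEmbOfFin h2).strictMono (B.orderEmbOfFin h3).strictMono]
      simp only [eA, eB]
      exact h4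
    · rw [union_iff]
      simp only [eA, eB]
      exact h1
    · simp only [eA, eB]
  · rintro ⟨a, b⟩ -
    congr 1
    unfold maj wt
    simp

theorem exp_eq (n k : ℕ) (hk : k ≤ n) :
    (2 * n + k * k - 3 * k) / 2 = (n - k) + k.choose 2 := by
  obtain ⟨m, rfl⟩ := Nat.exists_eq_add_of_le hk
  have h1 : k * (k - 1) = 2 * k.choose 2 := by
    rw [Nat.choose_two_right, Nat.mul_div_cancel' (Nat.even_mul_pred_self k).two_dvd]
  have h2 : k * k = k * (k - 1) + k := by
    cases k with
    | zero => rfl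
    | succ k => simp; ring
  omega

/-- [n−k+1]_q · Σ_{T ∈ RInc_k(2×n)} q^maj(T)
      = q^(n + k(k−3)/2) · [2n−k choose k]_q · [2n−2k choose n−k]_q,
where the exponent n + k(k−3)/2 is written as the natural number (2n + k² − 3k)/2. -/
theorem rqnk (n k : ℕ) (hn : 1 ≤ n) (hk : k ≤ n) :
    qInt (n - k + 1) * ∑ᶠ T ∈ RInc n k, (X : Polynomial ℤ) ^ maj T
      = X ^ ((2 * n + k * k - 3 * k) / 2) * (qBinom (2 * n - k) k
          * qBinom (2 * n - 2 * k) (n - k)) := by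
  rw [bridge, exp_eq n k hk]
  obtain ⟨m, rfl⟩ := Nat.exists_eq_add_of_le hk
  have h := TT_closed (N := 2 * (k + m) - k) (u := m) (d := m) (h := k) (by omega) le_rfl
    (T_closed _ _ _ _ (by omega) le_rfl)
  rw [show k + m = m + k by ring] at *
  rw [h, show m + k - k = m by omega, show 2 * (m + k) - 2 * k = 2 * m by omega]
  have := BU_final m
  rw [pow_add]
  linear_combination X ^ (k.choose 2) * qBinom (2 * (m + k) - k) k * this
end

section
/- For every positive integer n and every integer k with 0 ≤ k ≤ n, the number of row-increasing tableaux of shape 2×n with exactly k values appearing twice satisfies (n−k+1) · |RInc_k(2×n)| = C(2n−k, k) · C(2n−2k, n−k), where C denotes the ordinary binomial coefficient. -/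
/-- Pairs of subsets covering `{1, …, N}` of sizes `p`, `q` with the ballot condition. -/
def SS (N : ℕ) (p q : ℤ) : Set (Finset ℕ × Finset ℕ) :=
  {X | X.1 ∪ X.2 = Finset.Icc 1 N ∧ (X.1.card : ℤ) = p ∧ (X.2.card : ℤ) = q ∧
    ∀ m, (X.2.filter (· ≤ m)).card ≤ (X.1.filter (· ≤ m)).card}

/-- Trinomial coefficients, with integer indices. -/
def tri : ℕ → ℤ → ℤ → ℤ
  | 0, x, y => if x = 0 ∧ y = 0 then 1 else 0
  | N + 1, x, y => tri N (x - 1) y + tri N x (y - 1) + tri N x y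

theorem tri_symm (N : ℕ) : ∀ x y, tri N x y = tri N y x := by
  induction N with
  | zero => intro x y; simp [tri, and_comm]
  | succ N ih =>
    intro x y
    simp only [tri]
    rw [ih (x - 1) y, ih x (y - 1), ih x y]; ring

theorem tri_neg (N : ℕ) : ∀ x y, x < 0 → tri N x y = 0 := by
  induction N with
  | zero => intro x y h; simp [tri]; omega
  | succ N ih =>
    intro x y h
    simp only [tri]
    rw [ih _ _ h, ih _ _ h, ih (x - 1) y (by omega)]; ring

theorem tri_nat (N : ℕ) : ∀ x y : ℕ,
    tri N x y = (Nat.choose N (x + y) : ℤ) * Nat.choose (x + y) x := by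
  induction N with
  | zero =>
    intro x y
    rcases x with _ | x
    · rcases y with _ | y
      · simp [tri]
      · simp [tri]; omega
    · simp [tri, Nat.add_right_comm x 1 y]; omega
  | succ N ih =>
    intro x y
    simp only [tri]
    rcases x with _ | x
    · rw [tri_neg N _ _ (by simp)]
      rcases y with _ | y
      · rw [tri_symm, tri_neg N _ _ (by simp), ih]; simp
      · have := ih 0 y
        have e : ((y + 1 : ℕ) : ℤ) - 1 = y := by push_cast; ring
        rw [e, this, ih]
        simp [Nat.choose_succ_succ]
    · have e : ((x + 1 : ℕ) : ℤ) - 1 = x := by push_cast; ring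
      rw [e]
      rcases y with _ | y
      · rw [tri_symm N _ (((0 : ℕ) : ℤ) - 1), tri_neg N (((0 : ℕ) : ℤ) - 1) _ (by simp), ih, ih]
        simp [Nat.choose_succ_succ]
      · have e : ((y + 1 : ℕ) : ℤ) - 1 = y := by push_cast; ring
        rw [e, ih, ih, ih]
        have e1 : x + 1 + (y + 1) = (x + y + 1) + 1 := by ring
        have e2 : x + 1 + y = x + y + 1 := by ring
        have e3 : x + (y + 1) = x + y + 1 := by ring
        rw [e1, e2, e3, Nat.choose_succ_succ N, Nat.choose_succ_succ (x + y + 1) x]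
        push_cast; ring

theorem SS_finite (N : ℕ) (p q : ℤ) : (SS N p q).Finite := by
  apply Set.Finite.subset (((Finset.Icc 1 N).powerset ×ˢ (Finset.Icc 1 N).powerset).finite_toSet)
  rintro ⟨A, B⟩ ⟨h, -⟩
  simp only at h
  simp only [Finset.coe_product, Set.mem_prod, Finset.mem_coe, Finset.mem_powerset, ← h]
  exact ⟨Finset.subset_union_left, Finset.subset_union_right⟩

theorem SS_empty (N : ℕ) (p q : ℤ) (h : p < q) : SS N p q = ∅ := by
  ext ⟨A, B⟩
  simp only [SS, Set.mem_ofPred_eq, Set.mem_empty_iff_false, iff_false]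
  rintro ⟨h1, h2, h3, h4⟩
  have hA : ∀ x ∈ A, x ≤ N := fun x hx => by
    have : x ∈ Finset.Icc 1 N := h1 ▸ Finset.mem_union_left _ hx
    simp at this; omega
  have hB : ∀ x ∈ B, x ≤ N := fun x hx => by
    have : x ∈ Finset.Icc 1 N := h1 ▸ Finset.mem_union_right _ hx
    simp at this; omega
  have := h4 N
  rw [Finset.filter_true_of_mem hA, Finset.filter_true_of_mem hB] at this
  omega

/-- Adding the value `N+1` to the sets, depending on flags. -/
def putv (N : ℕ) (s t : Bool) (X : Finset ℕ × Finset ℕ) : Finset ℕ × Finset ℕ :=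
  (if s then insert (N + 1) X.1 else X.1, if t then insert (N + 1) X.2 else X.2)

theorem SS_le {N : ℕ} {p q : ℤ} {X} (h : X ∈ SS N p q) :
    (∀ x ∈ X.1, x ≤ N) ∧ (∀ x ∈ X.2, x ≤ N) := by
  obtain ⟨h1, -⟩ := h
  constructor
  · intro x hx
    have : x ∈ Finset.Icc 1 N := h1 ▸ Finset.mem_union_left _ hx
    simp at this; omega
  · intro x hx
    have : x ∈ Finset.Icc 1 N := h1 ▸ Finset.mem_union_right _ hx
    simp at this; omega

theorem putv_mem (N : ℕ) (s t : Bool) (hst : s || t) (p q : ℤ) (hpq : q ≤ p) (X)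
    (h : X ∈ SS N (p - if s then 1 else 0) (q - if t then 1 else 0)) :
    putv N s t X ∈ SS (N + 1) p q := by
  have hle := SS_le h
  obtain ⟨A, B⟩ := X
  obtain ⟨h1, h2, h3, h4⟩ := h
  obtain ⟨hA, hB⟩ := hle
  simp only at *
  have nA : N + 1 ∉ A := fun h => by have := hA _ h; omega
  have nB : N + 1 ∉ B := fun h => by have := hB _ h; omega
  have c1 : ((putv N s t (A, B)).1.card : ℤ) = p := by
    cases s <;> simp [putv, nA] at * <;> omega
  have c2 : ((putv N s t (A, B)).2.card : ℤ) = q := by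
    cases t <;> simp [putv, nB] at * <;> omega
  refine ⟨?_, c1, c2, ?_⟩
  · ext x
    have := Finset.ext_iff.1 h1 x
    simp only [Finset.mem_union, Finset.mem_Icc] at this ⊢
    cases s <;> cases t <;> simp [putv] at * <;> grind
  · intro m
    by_cases hm : m ≤ N
    · have e1 : (putv N s t (A, B)).1.filter (· ≤ m) = A.filter (· ≤ m) := by
        ext x; cases s <;> simp [putv]; grind
      have e2 : (putv N s t (A, B)).2.filter (· ≤ m) = B.filter (· ≤ m) := by
        ext x; cases t <;> simp [putv]; grind
      rw [e1, e2]; exact h4 m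
    · have e1 : (putv N s t (A, B)).1.filter (· ≤ m) = (putv N s t (A, B)).1 := by
        apply Finset.filter_true_of_mem
        intro x hx; cases s <;> simp [putv] at hx <;> grind
      have e2 : (putv N s t (A, B)).2.filter (· ≤ m) = (putv N s t (A, B)).2 := by
        apply Finset.filter_true_of_mem
        intro x hx; cases t <;> simp [putv] at hx <;> grind
      rw [e1, e2]; omega

theorem SS_erase (N : ℕ) (p q : ℤ) (X) (h : X ∈ SS (N + 1) p q) :
    ∃ s t : Bool, (s || t) = true ∧
      ∃ Y ∈ SS N (p - if s then 1 else 0) (q - if t then 1 else 0), putv N s t Y = X := by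
  have hle := SS_le h
  obtain ⟨A, B⟩ := X
  obtain ⟨h1, h2, h3, h4⟩ := h
  obtain ⟨hA, hB⟩ := hle
  simp only at *
  have h1' := fun x => Finset.ext_iff.1 h1 x
  simp only [Finset.mem_union, Finset.mem_Icc] at h1'
  refine ⟨decide (N + 1 ∈ A), decide (N + 1 ∈ B), ?_, (A.erase (N + 1), B.erase (N + 1)),
    ⟨?_, ?_, ?_, ?_⟩, ?_⟩
  · have := (h1' (N + 1)).2 (by omega)
    simpa using this
  · ext x
    have := h1' x
    simp only [Finset.mem_union, Finset.mem_Icc, Finset.mem_erase]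
    grind
  · by_cases hh : N + 1 ∈ A
    · have := Finset.card_erase_add_one hh
      simp only [hh, decide_true, if_true]; omega
    · simp [hh]; omega
  · by_cases hh : N + 1 ∈ B
    · have := Finset.card_erase_add_one hh
      simp only [hh, decide_true, if_true]; omega
    · simp [hh]; omega
  · intro m
    have e1 : (A.erase (N + 1)).filter (· ≤ m) = A.filter (· ≤ min m N) := by
      ext x; have := hA x; simp only [Finset.mem_filter, Finset.mem_erase]; grind
    have e2 : (B.erase (N + 1)).filter (· ≤ m) = B.filter (· ≤ min m N) := by
      ext x; have := hB x; simp only [Finset.mem_filter, Finset.mem_erase]; grind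
    simp only
    rw [e1, e2]; exact h4 _
  · unfold putv
    ext x <;> simp only [decide_eq_true_eq] <;> split_ifs <;> simp <;> grind

theorem SS_succ (N : ℕ) (p q : ℤ) (hpq : q ≤ p) :
    (SS (N + 1) p q).ncard
      = (SS N (p - 1) q).ncard + (SS N p (q - 1)).ncard + (SS N (p - 1) (q - 1)).ncard := by
  have key : SS (N + 1) p q = (Set.image (putv N true false) (SS N (p - 1) q) ∪
      Set.image (putv N false true) (SS N p (q - 1))) ∪ Set.image (putv N true true) (SS N (p - 1) (q - 1)) := by
    ext X
    constructor
    · intro h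
      obtain ⟨s, t, hst, Y, hY, e⟩ := SS_erase N p q X h
      cases s <;> cases t <;> simp at hst hY
      · exact Or.inl (Or.inr ⟨Y, hY, e⟩)
      · exact Or.inl (Or.inl ⟨Y, hY, e⟩)
      · exact Or.inr ⟨Y, hY, e⟩
    · rintro ((⟨Y, hY, rfl⟩ | ⟨Y, hY, rfl⟩) | ⟨Y, hY, rfl⟩)
      · exact putv_mem N true false rfl p q hpq Y (by simpa using hY)
      · exact putv_mem N false true rfl p q hpq Y (by simpa using hY)
      · exact putv_mem N true true rfl p q hpq Y (by simpa using hY)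
  have inj : ∀ s t p q, Set.InjOn (putv N s t) (SS N p q) := by
    intro s t p q X hX Y hY e
    have h1 := SS_le hX
    have h2 := SS_le hY
    simp only [putv, Prod.mk.injEq] at e
    obtain ⟨e1, e2⟩ := e
    have e1 := fun x => Finset.ext_iff.1 e1 x
    have e2 := fun x => Finset.ext_iff.1 e2 x
    ext x
    · have := e1 x; cases s <;> simp at this <;> grind
    · have := e2 x; cases t <;> simp at this <;> grind
  have fin : ∀ s t p q, (Set.image (putv N s t) (SS N p q)).Finite := fun s t p q => (SS_finite N p q).image _
  rw [key, Set.ncard_union_eq _ ((fin _ _ _ _).union (fin _ _ _ _)) (fin _ _ _ _),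
    Set.ncard_union_eq _ (fin _ _ _ _) (fin _ _ _ _),
    Set.InjOn.ncard_image (inj _ _ _ _), Set.InjOn.ncard_image (inj _ _ _ _),
    Set.InjOn.ncard_image (inj _ _ _ _)]
  · rw [Set.disjoint_left]
    rintro _ ⟨X, hX, rfl⟩ ⟨Y, hY, e⟩
    have h1 := SS_le hX
    have h2 := SS_le hY
    simp [putv] at e
    have := h1.2 (N + 1) (by rw [← e.2]; simp)
    omega
  · rw [Set.disjoint_left]
    rintro _ (⟨X, hX, rfl⟩ | ⟨X, hX, rfl⟩) ⟨Y, hY, e⟩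
    · have h1 := SS_le hX
      simp [putv] at e
      have := h1.2 (N + 1) (by rw [← e.2]; simp)
      omega
    · have h1 := SS_le hX
      simp [putv] at e
      have := h1.1 (N + 1) (by rw [← e.1]; simp)
      omega

theorem SS_card (N : ℕ) : ∀ p q : ℤ, q ≤ p + 1 →
    ((SS N p q).ncard : ℤ) = tri N (N - q) (N - p) - tri N (N - q + 1) (N - p - 1) := by
  induction N with
  | zero =>
    intro p q h
    by_cases h0 : p = 0 ∧ q = 0
    · obtain ⟨rfl, rfl⟩ := h0
      have : SS 0 0 0 = {(∅, ∅)} := by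
        ext ⟨A, B⟩
        simp only [SS, Set.mem_ofPred_eq, Set.mem_singleton_iff, Prod.mk.injEq]
        constructor
        · rintro ⟨-, h1, h2, -⟩
          simpa using And.intro h1 h2
        · rintro ⟨rfl, rfl⟩; simp
      rw [this]; simp [tri]
    · have : SS 0 p q = ∅ := by
        ext ⟨A, B⟩
        simp only [SS, Set.mem_ofPred_eq, Set.mem_empty_iff_false, iff_false]
        rintro ⟨h1, h2, h3, -⟩
        simp at h1
        obtain ⟨rfl, rfl⟩ := h1
        simp at h2 h3; omega
      rw [this]
      simp only [tri, Set.ncard_empty]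
      rw [if_neg (by simp; omega), if_neg (by simp; omega)]; simp
  | succ N ih =>
    intro p q h
    by_cases hpq : q ≤ p
    · rw [SS_succ N p q hpq]
      push_cast
      rw [ih (p - 1) q (by omega), ih p (q - 1) (by omega), ih (p - 1) (q - 1) (by omega)]
      simp only [tri]
      ring_nf
    · rw [SS_empty _ _ _ (by omega)]
      have : q = p + 1 := by omega
      subst this
      rw [tri_symm _ (_ + 1)]
      simp only [Set.ncard_empty]
      ring_nf
      try simp

theorem ballot_iff {n : ℕ} (a b : Fin n → ℕ) (ha : StrictMono a) (hb : StrictMono b) :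
    (∀ i, a i ≤ b i) ↔ ∀ m, ((Finset.univ.image b).filter (· ≤ m)).card ≤
      ((Finset.univ.image a).filter (· ≤ m)).card := by
  have hc : ∀ (f : Fin n → ℕ), StrictMono f → ∀ m,
      ((Finset.univ.image f).filter (· ≤ m)).card = (Finset.univ.filter (fun i => f i ≤ m)).card := by
    intro f hf m
    rw [Finset.filter_image, Finset.card_image_of_injective _ hf.injective]
  simp only [hc a ha, hc b hb]
  constructor
  · intro h m
    apply Finset.card_le_card
    intro i
    simp only [Finset.mem_filter, Finset.mem_univ, true_and]
    exact (h i).trans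
  · intro h i
    by_contra hlt
    have h1 : (Finset.Iic i).card ≤ (Finset.univ.filter (fun j => b j ≤ b i)).card := by
      apply Finset.card_le_card
      intro j hj
      simpa using hb.monotone (Finset.mem_Iic.1 hj)
    have h2 : (Finset.univ.filter (fun j => a j ≤ b i)).card ≤ (Finset.Iio i).card := by
      apply Finset.card_le_card
      intro j hj
      simp at hj
      rw [Finset.mem_Iio]
      by_contra hij
      have := ha.monotone (not_lt.1 hij)
      omega
    have := h (b i)
    simp at h1 h2
    omega

theorem RInc_card (n k : ℕ) : (RInc n k).ncard = (SS (2 * n - k) n n).ncard := by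
  apply Set.ncard_congr (fun T _ => (Finset.univ.image T.1, Finset.univ.image T.2))
  · rintro ⟨a, b⟩ ⟨ha, hb, hab, hr⟩
    simp only at *
    refine ⟨?_, ?_, ?_, (ballot_iff a b ha hb).1 hab⟩
    · rw [← Finset.coe_inj]; simpa using hr
    · simp [Finset.card_image_of_injective _ ha.injective]
    · simp [Finset.card_image_of_injective _ hb.injective]
  · rintro ⟨a, b⟩ ⟨c, d⟩ ⟨ha, hb, -⟩ ⟨hc, hd, -⟩ e
    simp only [Prod.mk.injEq] at *
    obtain ⟨e1, e2⟩ := e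
    rw [← Finset.coe_inj] at e1 e2
    simp at e1 e2
    exact ⟨(ha.range_inj hc).1 e1, (hb.range_inj hd).1 e2⟩
  · rintro ⟨A, B⟩ ⟨h1, h2, h3, h4⟩
    simp only at *
    have hA : A.card = n := by exact_mod_cast h2
    have hB : B.card = n := by exact_mod_cast h3
    have rA : Finset.univ.image (A.orderEmbOfFin hA) = A := by
      rw [← Finset.coe_inj]; simp
    have rB : Finset.univ.image (B.orderEmbOfFin hB) = B := by
      rw [← Finset.coe_inj]; simp
    refine ⟨(A.orderEmbOfFin hA, B.orderEmbOfFin hB),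
      ⟨(A.orderEmbOfFin hA).strictMono, (B.orderEmbOfFin hB).strictMono, ?_, ?_⟩, ?_⟩
    · refine (ballot_iff _ _ (A.orderEmbOfFin hA).strictMono (B.orderEmbOfFin hB).strictMono).2 ?_
      rw [rA, rB]; exact h4
    · have := Finset.coe_inj.2 h1
      simpa using this
    · simp only [rA, rB]

/-- (n−k+1) · |RInc_k(2×n)| = C(2n−k, k) · C(2n−2k, n−k). -/
theorem rnk (n k : ℕ) (hn : 1 ≤ n) (hk : k ≤ n) :
    (n - k + 1) * (RInc n k).ncard
      = Nat.choose (2 * n - k) k * Nat.choose (2 * n - 2 * k) (n - k) := by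
  rw [RInc_card]
  obtain ⟨m, rfl⟩ := Nat.exists_eq_add_of_le hk
  have e1 : k + m - k = m := by omega
  have e2 : 2 * (k + m) - k = k + 2 * m := by omega
  have e3 : 2 * (k + m) - 2 * k = 2 * m := by omega
  rw [e1, e2, e3]
  have h := SS_card (k + 2 * m) ((k + m : ℕ) : ℤ) ((k + m : ℕ) : ℤ) (by omega)
  have e4 : ((k + 2 * m : ℕ) : ℤ) - ((k + m : ℕ) : ℤ) = (m : ℕ) := by push_cast; ring
  rw [e4, tri_nat] at h
  have e5 : Nat.choose (k + 2 * m) (m + m) = Nat.choose (k + 2 * m) k := by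
    rw [← two_mul, Nat.choose_symm_add]
  rw [e5] at h
  generalize (SS (k + 2 * m) ((k + m : ℕ) : ℤ) ((k + m : ℕ) : ℤ)).ncard = c at h ⊢
  zify
  rw [h]
  rcases m with _ | m
  · rw [tri_symm, tri_neg _ _ _ (by simp)]; simp
  · have e6 : ((m + 1 : ℕ) : ℤ) - 1 = (m : ℕ) := by push_cast; ring
    have e7 : ((m + 1 : ℕ) : ℤ) + 1 = (m + 2 : ℕ) := by push_cast; ring
    rw [e6, e7, tri_nat]
    have e8 : m + 2 + m = m + 1 + (m + 1) := by ring
    rw [e8, e5, two_mul]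
    have := Nat.choose_succ_right_eq (m + 1 + (m + 1)) (m + 1)
    have e9 : m + 1 + (m + 1) - (m + 1) = m + 1 := by omega
    rw [e9] at this
    zify at this
    push_cast at this ⊢
    linear_combination (-(Nat.choose (k + (m + 1 + (m + 1))) k : ℤ)) * this
end
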